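/- arXiv:2505.19527 — 2 statements merged into one kernel-verified Lean document; each statement's English description precedes it below -/
import Mathlib

section
/- Let φ : ℝ^d → ℝ be a continuous bounded function. Then for every fixed θ ∈ ℝ^d, φ_ρ(θ) − ρ → sup φ as ρ → +∞ (pointwise convergence). -/
noncomputable section

/-- The `ρ`-offset function of `ψ : ℝ^d → ℝ`:
`ψ_ρ(θ) = sup { y : ∃ θ', ‖θ' − θ‖² + (y − ψ(θ'))² < ρ² }`. -/
def offsetFun {d : ℕ} (ψ : EuclideanSpace ℝ (Fin d) → ℝ) (ρ : ℝ)
    (θ : EuclideanSpace ℝ (Fin d)) : ℝ :=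
  sSup { y : ℝ | ∃ θ' : EuclideanSpace ℝ (Fin d), ‖θ' - θ‖ ^ 2 + (y - ψ θ') ^ 2 < ρ ^ 2 }

/-- Every height admissible in the definition of `offsetFun ψ ρ θ` is at most `sup ψ + ρ`. -/
theorem le_sSup_range_add {d : ℕ} {ψ : EuclideanSpace ℝ (Fin d) → ℝ} {ρ y : ℝ}
    {θ θ' : EuclideanSpace ℝ (Fin d)} (hψ : BddAbove (Set.range ψ)) (hρ : 0 ≤ ρ)
    (hy : ‖θ' - θ‖ ^ 2 + (y - ψ θ') ^ 2 < ρ ^ 2) : y ≤ sSup (Set.range ψ) + ρ := by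
  have hy' : y - ψ θ' ≤ ρ := (abs_le_of_sq_le_sq' (by nlinarith [sq_nonneg ‖θ' - θ‖]) hρ).2
  linarith [le_csSup hψ ⟨θ', rfl⟩]

theorem le_offsetFun {d : ℕ} {ψ : EuclideanSpace ℝ (Fin d) → ℝ} {ρ y : ℝ}
    {θ θ' : EuclideanSpace ℝ (Fin d)} (hψ : BddAbove (Set.range ψ)) (hρ : 0 ≤ ρ)
    (hy : ‖θ' - θ‖ ^ 2 + (y - ψ θ') ^ 2 < ρ ^ 2) : y ≤ offsetFun ψ ρ θ :=
  le_csSup ⟨_, fun _ ⟨_, hz⟩ => le_sSup_range_add hψ hρ hz⟩ ⟨θ', hy⟩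

theorem offsetFun_le {d : ℕ} {ψ : EuclideanSpace ℝ (Fin d) → ℝ} {ρ : ℝ}
    (hψ : BddAbove (Set.range ψ)) (hρ : 0 < ρ) (θ : EuclideanSpace ℝ (Fin d)) :
    offsetFun ψ ρ θ ≤ sSup (Set.range ψ) + ρ :=
  csSup_le ⟨ψ θ, θ, by simpa using pow_pos hρ 2⟩
    fun _ ⟨_, hz⟩ => le_sSup_range_add hψ hρ.le hz

/-- **Weak ironing (pointwise version).**
For a continuous bounded `φ : ℝ^d → ℝ` and every fixed `θ`,
`φ_ρ(θ) − ρ → sup φ` as `ρ → +∞`. -/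
theorem weak_ironing_pointwise {d : ℕ}
    (φ : EuclideanSpace ℝ (Fin d) → ℝ)
    (hcont : Continuous φ) (hbdd : ∃ M : ℝ, ∀ θ, |φ θ| ≤ M)
    (θ : EuclideanSpace ℝ (Fin d)) :
    Filter.Tendsto (fun ρ => offsetFun φ ρ θ - ρ) Filter.atTop
      (nhds (sSup (Set.range φ))) := by
  obtain ⟨M, hM⟩ := hbdd
  have hφ : BddAbove (Set.range φ) := ⟨M, by rintro _ ⟨x, rfl⟩; exact (abs_le.1 (hM x)).2⟩
  refine tendsto_order.2 ⟨fun a ha => ?_, fun b hb => ?_⟩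
  · obtain ⟨_, ⟨θ', rfl⟩, hθ'⟩ := exists_lt_of_lt_csSup (Set.range_nonempty φ) ha
    obtain ⟨ε, hε, haε⟩ : ∃ ε > 0, a + ε < φ θ' := ⟨(φ θ' - a) / 2, by linarith, by linarith⟩
    filter_upwards [Filter.eventually_gt_atTop 0,
      Filter.eventually_gt_atTop ((‖θ' - θ‖ ^ 2 + ε ^ 2) / (2 * ε))] with ρ hρ hρε
    rw [div_lt_iff₀ (by positivity)] at hρε
    have hle : φ θ' + ρ - ε ≤ offsetFun φ ρ θ := le_offsetFun (θ' := θ') hφ hρ.le (by linarith)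
    linarith
  · filter_upwards [Filter.eventually_gt_atTop 0] with ρ hρ
    linarith [offsetFun_le hφ hρ θ]
end
end

section
/- Let f : ℝ^d → ℝ be a twice continuously differentiable (C²) function with a local minimum at θ₀ ∈ ℝ^d, and let σ = ‖Hess f(θ₀)‖ > 0 be the operator norm of the Hessian of f at θ₀. Then for every ρ > 1/σ, the ball of radius ρ centered at the point c = (θ₀, f(θ₀) + ρ) (the center directly above the minimum, tangent to the graph at (θ₀, f(θ₀))) penetrates the graph of f: there exists θ' ∈ ℝ^d with ‖θ' − θ₀‖² + (f(θ') − f(θ₀) − ρ)² < ρ². -/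
open Filter Topology

/-- Strict form of the second derivative test for a local maximum. -/
theorem eventually_lt_of_hasDerivAt_of_neg {φ φ' : ℝ → ℝ} {c x : ℝ}
    (hφ : ∀ t, HasDerivAt φ (φ' t) t) (hx : φ' x = 0) (hφ' : HasDerivAt φ' c x) (hc : c < 0) :
    ∀ᶠ t in 𝓝[≠] x, φ t < φ x := by
  have h1 : ∀ t, HasDerivAt (fun t => φ t - c / 4 * (t - x) ^ 2) (φ' t - c / 2 * (t - x)) t := by
    intro t
    refine ((hφ t).sub ((((hasDerivAt_id' t).sub_const x).pow 2).const_mul (c / 4))).congr_deriv ?_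
    simp
    ring
  have h2 : HasDerivAt (fun t => φ' t - c / 2 * (t - x)) (c / 2) x := by
    refine (hφ'.sub (((hasDerivAt_id' x).sub_const x).const_mul (c / 2))).congr_deriv ?_
    ring
  have hd : deriv (fun t => φ t - c / 4 * (t - x) ^ 2) = fun t => φ' t - c / 2 * (t - x) :=
    funext fun t => (h1 t).deriv
  have hmax : IsLocalMax (fun t => φ t - c / 4 * (t - x) ^ 2) x := by
    refine isLocalMax_of_deriv_deriv_neg ?_ ?_ (h1 x).continuousAt
    · rw [hd, h2.deriv]
      linarith
    · rw [hd]
      simp [hx]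
  filter_upwards [hmax.filter_mono nhdsWithin_le_nhds, self_mem_nhdsWithin] with t ht hne
  have hpos : 0 < (t - x) ^ 2 := by
    have := sub_ne_zero.mpr hne
    positivity
  simp only [sub_self] at ht
  nlinarith

section LineRestriction

variable {E : Type*} [NormedAddCommGroup E] [NormedSpace ℝ E] {f : E → ℝ}

theorem ContDiff.hasDerivAt_comp_add_smul (hf : ContDiff ℝ 2 f) (a v : E) (t : ℝ) :
    HasDerivAt (fun t : ℝ => f (a + t • v)) (fderiv ℝ f (a + t • v) v) t := by
  have hl : HasDerivAt (fun t : ℝ => a + t • v) v t := by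
    simpa using ((hasDerivAt_id t).smul_const v).const_add a
  exact ((hf.differentiable (by norm_num)) _).hasFDerivAt.comp_hasDerivAt t hl

theorem ContDiff.hasDerivAt_fderiv_comp_add_smul (hf : ContDiff ℝ 2 f) (a v : E) :
    HasDerivAt (fun t : ℝ => fderiv ℝ f (a + t • v) v) (fderiv ℝ (fderiv ℝ f) a v v) 0 := by
  have hl : HasDerivAt (fun t : ℝ => a + t • v) v 0 := by
    simpa using ((hasDerivAt_id (0 : ℝ)).smul_const v).const_add a
  have hd : Differentiable ℝ (fderiv ℝ f) :=
    (hf.fderiv_right (m := 1) (by norm_num)).differentiable (by norm_num)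
  have h := (hd (a + (0 : ℝ) • v)).hasFDerivAt.comp_hasDerivAt (0 : ℝ) hl
  simpa using h.clm_apply (hasDerivAt_const (0 : ℝ) v)

/-- The second derivative at a local minimum is positive semidefinite. -/
theorem IsLocalMin.fderiv_fderiv_nonneg (hf : ContDiff ℝ 2 f) {a : E} (hmin : IsLocalMin f a)
    (v : E) : 0 ≤ fderiv ℝ (fderiv ℝ f) a v v := by
  by_contra! hneg
  have hlt := eventually_lt_of_hasDerivAt_of_neg (hf.hasDerivAt_comp_add_smul a v)
    (by simp [hmin.fderiv_eq_zero]) (hf.hasDerivAt_fderiv_comp_add_smul a v) hneg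
  have hlim : Tendsto (fun t : ℝ => a + t • v) (𝓝[≠] 0) (𝓝 a) := by
    have : Continuous fun t : ℝ => a + t • v := by fun_prop
    simpa using (this.tendsto 0).mono_left (nhdsWithin_le_nhds (s := {0}ᶜ))
  obtain ⟨t, h1, h2⟩ := (hlt.and (hlim.eventually hmin)).exists
  simp only [zero_smul, add_zero] at h1
  exact absurd h1 h2.not_gt

end LineRestriction

/-- A symmetric positive semidefinite bilinear form bounded by `C` on the diagonal has operator
norm at most `C`. -/
theorem ContinuousLinearMap.opNorm_le_of_apply_self_le {E : Type*} [NormedAddCommGroup E]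
    [NormedSpace ℝ E] (B : E →L[ℝ] E →L[ℝ] ℝ) (hsymm : ∀ v w, B v w = B w v)
    (hnonneg : ∀ v, 0 ≤ B v v) {C : ℝ} (hC : 0 ≤ C) (h : ∀ v, B v v ≤ C * ‖v‖ ^ 2) :
    ‖B‖ ≤ C := by
  refine B.opNorm_le_bound₂ hC fun v w => ?_
  have hcs : B v w * B w v ≤ B v v * B w w :=
    LinearMap.BilinForm.apply_mul_apply_le_of_forall_zero_le B.toBilinForm hnonneg v w
  rw [hsymm w v] at hcs
  refine abs_le_of_sq_le_sq (a := B v w) ?_ (by positivity)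
  calc B v w ^ 2 ≤ B v v * B w w := by rw [sq]; exact hcs
    _ ≤ (C * ‖v‖ ^ 2) * (C * ‖w‖ ^ 2) := by
      gcongr
      exacts [hnonneg w, h v, h w]
    _ = (C * ‖v‖ * ‖w‖) ^ 2 := by ring

/-- If `f` is `C²` with a local minimum at `θ₀` and `σ = ‖Hess f(θ₀)‖ > 0`,
then for every `ρ > 1/σ` the ball of radius `ρ` centered at
`c = (θ₀, f(θ₀) + ρ)` penetrates the graph of `f`: there is `θ'` with
`‖θ' − θ₀‖² + (f(θ') − f(θ₀) − ρ)² < ρ²`. -/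
theorem tangent_ball_penetrates_graph {d : ℕ}
    (f : EuclideanSpace ℝ (Fin d) → ℝ) (hf : ContDiff ℝ 2 f)
    (θ₀ : EuclideanSpace ℝ (Fin d)) (hmin : IsLocalMin f θ₀)
    (hσ : 0 < ‖fderiv ℝ (fderiv ℝ f) θ₀‖) :
    ∀ ρ : ℝ, 1 / ‖fderiv ℝ (fderiv ℝ f) θ₀‖ < ρ →
      ∃ θ' : EuclideanSpace ℝ (Fin d),
        ‖θ' - θ₀‖ ^ 2 + (f θ' - f θ₀ - ρ) ^ 2 < ρ ^ 2 := by
  intro ρ hρ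
  have hρ0 : 0 < ρ := lt_trans (by positivity) hρ
  obtain ⟨v, hv⟩ : ∃ v, 1 / ρ * ‖v‖ ^ 2 < fderiv ℝ (fderiv ℝ f) θ₀ v v := by
    by_contra! hle
    have hsymm : IsSymmSndFDerivAt ℝ f θ₀ := hf.contDiffAt.isSymmSndFDerivAt (by simp)
    have hnorm := ContinuousLinearMap.opNorm_le_of_apply_self_le _ hsymm.eq
      (hmin.fderiv_fderiv_nonneg hf) (by positivity) hle
    exact absurd hnorm ((one_div_lt hσ hρ0).mp hρ).not_ge
  have hD := hf.hasDerivAt_comp_add_smul θ₀ v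
  have hD2 := hf.hasDerivAt_fderiv_comp_add_smul θ₀ v
  have hψ : ∀ t : ℝ, HasDerivAt
      (fun t : ℝ => t ^ 2 * ‖v‖ ^ 2 + (f (θ₀ + t • v) - f θ₀ - ρ) ^ 2)
      (2 * t * ‖v‖ ^ 2 + 2 * (f (θ₀ + t • v) - f θ₀ - ρ) * fderiv ℝ f (θ₀ + t • v) v) t := by
    intro t
    refine ((((hasDerivAt_id' t).pow 2).mul_const (‖v‖ ^ 2)).add
      ((((hD t).sub_const (f θ₀)).sub_const ρ).pow 2)).congr_deriv ?_
    simp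
  have hψ' : HasDerivAt (fun t : ℝ => 2 * t * ‖v‖ ^ 2 +
      2 * (f (θ₀ + t • v) - f θ₀ - ρ) * fderiv ℝ f (θ₀ + t • v) v)
      (2 * ‖v‖ ^ 2 - 2 * ρ * fderiv ℝ (fderiv ℝ f) θ₀ v v) 0 := by
    refine ((((hasDerivAt_id' (0 : ℝ)).const_mul 2).mul_const (‖v‖ ^ 2)).add
      (((((hD 0).sub_const (f θ₀)).sub_const ρ).const_mul 2).mul hD2)).congr_deriv ?_
    simp [hmin.fderiv_eq_zero]
    ring
  have hneg : 2 * ‖v‖ ^ 2 - 2 * ρ * fderiv ℝ (fderiv ℝ f) θ₀ v v < 0 := by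
    rw [one_div, inv_mul_lt_iff₀ hρ0] at hv
    linarith
  obtain ⟨t, ht⟩ := (eventually_lt_of_hasDerivAt_of_neg hψ
    (by simp [hmin.fderiv_eq_zero]) hψ' hneg).exists
  refine ⟨θ₀ + t • v, ?_⟩
  simpa [norm_smul, mul_pow] using ht
end
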